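/- There is a universal constant C > 0 such that for every real p ≥ 2, every integer d ≥ 3, every finite subset M of ℓ_p^d, and every Δ > 0, the metric space M admits a (C·(min{p, log d})^4·√d, Δ)-Lipschitz decomposition. -/

import Mathlib

noncomputable section

open scoped NNReal ENNReal

/-- A `(β, Δ)`-Lipschitz decomposition of a (pseudo)metric space `α`: a probability
distribution over partitions of `α` (encoded as equivalence relations / setoids) such that
every cluster of every partition in the support has diameter at most `Δ` (i.e. any two
equivalent points are at distance at most `Δ`), and any two points `x, y` are separated
(put in different clusters) with probability at most `β * dist x y / Δ`. -/
def LipschitzDecomp (α : Type*) [PseudoMetricSpace α] (β Δ : ℝ) : Prop :=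
  ∃ D : PMF (Setoid α),
    (∀ R ∈ D.support, ∀ x y : α, R.r x y → dist x y ≤ Δ) ∧
    (∀ x y : α, D.toOuterMeasure {R | ¬ R.r x y} ≤ ENNReal.ofReal (β * dist x y / Δ))

/-- Carve the set `S` out as a cluster, and partition the complement of `S` according to `R`. -/
def carve {α : Type*} (S : Finset α) (R : Setoid α) : Setoid α where
  r x y := (x ∈ S ∧ y ∈ S) ∨ (x ∉ S ∧ y ∉ S ∧ R.r x y)
  iseqv :=
    { refl := fun x => by
        by_cases hx : x ∈ S
        · exact Or.inl ⟨hx, hx⟩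
        · exact Or.inr ⟨hx, hx, R.refl x⟩
      symm := by
        rintro x y (⟨hx, hy⟩ | ⟨hx, hy, h⟩)
        · exact Or.inl ⟨hy, hx⟩
        · exact Or.inr ⟨hy, hx, R.symm h⟩
      trans := by
        rintro x y z (⟨hx, hy⟩ | ⟨hx, hy, h⟩) (⟨hy', hz⟩ | ⟨hy', hz, h'⟩)
        · exact Or.inl ⟨hx, hz⟩
        · exact absurd hy hy'
        · exact absurd hy' hy
        · exact Or.inr ⟨hx, hz, R.trans h h'⟩ }

lemma carve_apply {α : Type*} (S : Finset α) (R : Setoid α) (x y : α) :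
    carve S R x y ↔ (x ∈ S ∧ y ∈ S) ∨ (x ∉ S ∧ y ∉ S ∧ R x y) := Iff.rfl

lemma toOuterMeasure_map_carve_le {α : Type*} [DecidableEq α] (S : Finset α) (D : PMF (Setoid α)) (x y : α) :
    (D.map (carve S)).toOuterMeasure {R | ¬ R.r x y} ≤
      (if (x ∈ S ↔ y ∈ S) then 0 else 1) +
        (if x ∈ S then 0 else D.toOuterMeasure {R | ¬ R.r x y}) := by
  rw [PMF.toOuterMeasure_map_apply]
  by_cases hxy : x ∈ S ↔ y ∈ S
  · by_cases hx : x ∈ S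
    · have hy := hxy.1 hx
      have : (carve S ⁻¹' {R : Setoid α | ¬ R.r x y}) = ∅ := by
        ext R
        simp [carve_apply, hx, hy]
      simp [this]
    · have hy : y ∉ S := fun h => hx (hxy.2 h)
      have : (carve S ⁻¹' {R : Setoid α | ¬ R.r x y}) = {R | ¬ R.r x y} := by
        ext R
        simp [carve_apply, hx, hy]
      simp [this, hx, hy]
  · rw [if_neg hxy]
    refine le_trans ?_ le_self_add
    rw [PMF.toOuterMeasure_apply, ← D.tsum_coe]
    exact ENNReal.tsum_le_tsum fun R => Set.indicator_le_self' (fun _ _ => zero_le) R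

/-- A weighted family of clusters that covers all points uniformly and separates `x` from `y`
with relative weight at most `ε x y` can be turned into a random partition. -/
lemma exists_pmf_setoid_of_weights {α : Type*} [Fintype α] [DecidableEq α]
    (w : Finset α → ℝ≥0∞) (hw : ∀ S, w S ≠ ⊤) (a : ℝ≥0∞) (ha : a ≠ 0)
    (ε : α → α → ℝ≥0∞) (P : α → α → Prop) (hP : ∀ x, P x x)
    (hcover : ∀ x, ∑ S with x ∈ S, w S = a)
    (hsep : ∀ x y, ∑ S : Finset α with ¬ (x ∈ S ↔ y ∈ S), w S ≤ ε x y * a)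
    (hclust : ∀ S, w S ≠ 0 → ∀ x ∈ S, ∀ y ∈ S, P x y) :
    ∃ D : PMF (Setoid α), (∀ R ∈ D.support, ∀ x y, R.r x y → P x y) ∧
      ∀ x y, D.toOuterMeasure {R | ¬ R.r x y} ≤ ε x y := by
  suffices H : ∀ N : Finset α, ∃ D : PMF (Setoid α),
      (∀ R ∈ D.support, ∀ x y, R.r x y → P x y) ∧
      ∀ x ∈ N, ∀ y ∈ N, D.toOuterMeasure {R | ¬ R.r x y} ≤ ε x y by
    obtain ⟨D, h1, h2⟩ := H Finset.univ
    exact ⟨D, h1, fun x y => h2 x (Finset.mem_univ x) y (Finset.mem_univ y)⟩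
  intro N
  induction N using Finset.strongInduction with
  | H N ih =>
    rcases N.eq_empty_or_nonempty with rfl | ⟨x₀, hx₀⟩
    · refine ⟨PMF.pure ⊥, ?_, by simp⟩
      intro R hR x y hxy
      rw [PMF.support_pure, Set.mem_singleton_iff] at hR
      subst hR
      have : x = y := hxy
      exact this ▸ hP x
    · have ih' : ∀ S : Finset α, ∃ D : PMF (Setoid α), ¬ Disjoint S N →
          (∀ R ∈ D.support, ∀ x y, R.r x y → P x y) ∧
          ∀ x ∈ N \ S, ∀ y ∈ N \ S, D.toOuterMeasure {R | ¬ R.r x y} ≤ ε x y := by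
        intro S
        by_cases hS : Disjoint S N
        · exact ⟨PMF.pure ⊥, fun h => absurd hS h⟩
        · have hlt : N \ S ⊂ N := by
            refine Finset.ssubset_iff_subset_ne.2 ⟨Finset.sdiff_subset, fun h => hS ?_⟩
            exact (Finset.sdiff_eq_self_iff_disjoint.1 h).symm
          obtain ⟨D, hD⟩ := ih _ hlt
          exact ⟨D, fun _ => hD⟩
      choose D' hD' using ih'
      set w' : Finset α → ℝ≥0∞ := fun S => if Disjoint S N then 0 else w S with hw'
      have hw'w : ∀ S, w' S ≤ w S := fun S => by
        simp only [hw']; split_ifs <;> simp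
      have hsplit : ∀ x ∈ N, ∑ S, w' S = a + ∑ S with x ∉ S, w' S := by
        intro x hx
        rw [← Finset.sum_filter_add_sum_filter_not Finset.univ (fun S => x ∈ S) w', ← hcover x]
        congr 1
        refine Finset.sum_congr rfl fun S hS => ?_
        have hxS := (Finset.mem_filter.1 hS).2
        simp only [hw']
        rw [if_neg]
        exact fun h => Finset.disjoint_left.1 h hxS hx
      have hW0 : ∑' S, w' S ≠ 0 := by
        rw [tsum_fintype, hsplit x₀ hx₀]
        simp [ha]
      have hWt : ∑' S, w' S ≠ ⊤ := by
        rw [tsum_fintype]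
        exact ENNReal.sum_ne_top.2 fun S _ => ne_top_of_le_ne_top (hw S) (hw'w S)
      refine ⟨(PMF.normalize w' hW0 hWt).bind fun S => (D' S).map (carve S), ?_, ?_⟩
      · intro R hR x y hxy
        rw [PMF.mem_support_bind_iff] at hR
        obtain ⟨S, hS, hR⟩ := hR
        rw [PMF.mem_support_normalize_iff] at hS
        rw [PMF.mem_support_map_iff] at hR
        obtain ⟨R', hR', rfl⟩ := hR
        have hSN : ¬ Disjoint S N := fun h => hS (by simp [hw', h])
        have hwS : w S ≠ 0 := fun h => hS (by simp [hw', h])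
        rcases hxy with ⟨hx, hy⟩ | ⟨-, -, h⟩
        · exact hclust S hwS x hx y hy
        · exact (hD' S hSN).1 R' hR' x y h
      · intro x hx y hy
        rw [PMF.toOuterMeasure_bind_apply, tsum_fintype]
        simp only [PMF.normalize_apply]
        have hterm : ∀ S, w' S * ((D' S).map (carve S)).toOuterMeasure {R | ¬ R.r x y} ≤
            (if ¬ (x ∈ S ↔ y ∈ S) then w S else 0) + (if x ∉ S then ε x y * w' S else 0) := by
          intro S
          by_cases hSN : Disjoint S N
          · simp [hw', hSN]
          by_cases hxy : x ∈ S ↔ y ∈ S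
          · refine (mul_le_mul_right (toOuterMeasure_map_carve_le S (D' S) x y) _).trans ?_
            by_cases hxS : x ∈ S
            · simp [hxy.1 hxS, hxS]
            · have hyS : y ∉ S := fun h => hxS (hxy.2 h)
              have := (hD' S hSN).2 x (by simp [hx, hxS]) y (by simp [hy, hyS])
              simp only [hxS, hyS, if_true, if_false, zero_add, not_true, not_false_iff]
              rw [mul_comm]
              exact mul_le_mul_left this _
          · rw [if_pos hxy]
            refine le_trans ?_ le_self_add
            calc _ ≤ w' S * 1 := by
                  gcongr
                  rw [PMF.toOuterMeasure_apply, ← ((D' S).map (carve S)).tsum_coe]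
                  exact ENNReal.tsum_le_tsum fun R => Set.indicator_le_self' (fun _ _ => zero_le) R
              _ ≤ w S := by rw [mul_one]; exact hw'w S
        have hsum : ∑ S, w' S * ((D' S).map (carve S)).toOuterMeasure {R | ¬ R.r x y} ≤
            ε x y * ∑ S, w' S := by
          refine (Finset.sum_le_sum fun S _ => hterm S).trans ?_
          rw [Finset.sum_add_distrib, ← Finset.sum_filter, ← Finset.sum_filter,
            ← Finset.mul_sum, hsplit x hx, mul_add]
          gcongr
          exact hsep x y
        rw [tsum_fintype] at hW0 hWt
        calc _ = (∑ S, w' S * ((D' S).map (carve S)).toOuterMeasure {R | ¬ R.r x y}) *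
              (∑ S, w' S)⁻¹ := by
              rw [Finset.sum_mul, tsum_fintype]
              exact Finset.sum_congr rfl fun S _ => by ring
          _ ≤ ε x y * (∑ S, w' S) * (∑ S, w' S)⁻¹ := by gcongr
          _ = ε x y := by rw [mul_assoc, ENNReal.mul_inv_cancel hW0 hWt, mul_one]

open MeasureTheory Set in
/-- Nonnegative functions on a common measure space, indexed by the points of a finite set and
with equal integrals, induce a random partition that separates `x` from `y` with probability
controlled by the `L¹` distance of the functions of `x` and `y`. -/
lemma exists_pmf_setoid_of_densities {α Ω : Type*} [Fintype α] [MeasurableSpace Ω]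
    (μ : Measure Ω) [SFinite μ] (f : α → Ω → ℝ) (hm : ∀ x, Measurable (f x))
    (hInt : ∀ x, Integrable (f x) μ) (h0 : ∀ x ω, 0 ≤ f x ω) (c : ℝ) (hc : 0 < c)
    (hfc : ∀ x, ∫ ω, f x ω ∂μ = c) (ε : α → α → ℝ)
    (hε : ∀ x y, ∫ ω, |f x ω - f y ω| ∂μ ≤ ε x y * c)
    (P : α → α → Prop) (hP : ∀ x, P x x)
    (hfP : ∀ x y ω, 0 < f x ω → 0 < f y ω → P x y) :
    ∃ D : PMF (Setoid α), (∀ R ∈ D.support, ∀ x y, R.r x y → P x y) ∧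
      ∀ x y, D.toOuterMeasure {R | ¬ R.r x y} ≤ ENNReal.ofReal (ε x y) := by
  classical
  let ν := μ.prod (volume : Measure ℝ)
  let A : α → Set (Ω × ℝ) := fun x => {z | 0 < z.2 ∧ z.2 < f x z.1}
  have hA : ∀ x, MeasurableSet (A x) := fun x =>
    (measurableSet_lt measurable_const measurable_snd).inter
      (measurableSet_lt measurable_snd ((hm x).comp measurable_fst))
  let cell : Finset α → Set (Ω × ℝ) := fun S => {z | ∀ x, x ∈ S ↔ z ∈ A x}
  have hcell : ∀ S, MeasurableSet (cell S) := by
    intro S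
    have : cell S = ⋂ x, {z | x ∈ S ↔ z ∈ A x} := by ext z; simp [cell]
    rw [this]
    refine MeasurableSet.iInter fun x => ?_
    by_cases hx : x ∈ S
    · simpa [hx] using hA x
    · simp only [hx, false_iff]
      exact (hA x).compl
  have hdisj : ∀ 𝒮 : Set (Finset α), 𝒮.PairwiseDisjoint cell := by
    intro 𝒮 S _ T _ hST
    refine Set.disjoint_left.2 fun z hS hT => hST ?_
    ext x
    exact (hS x).trans (hT x).symm
  have hunion : ∀ (Q : Finset α → Prop) [DecidablePred Q],
      ∑ S with Q S, ν (cell S) = ν {z | Q (Finset.univ.filter fun x => z ∈ A x)} := by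
    intro Q _
    rw [← measure_biUnion_finset (hdisj _) (fun S _ => hcell S)]
    congr 1
    ext z
    simp only [mem_iUnion, Finset.mem_filter, Finset.mem_univ, true_and, mem_ofPred_eq, exists_prop]
    constructor
    · rintro ⟨S, hS, hz⟩
      convert hS
      ext x
      simpa using (hz x).symm
    · intro h
      exact ⟨_, h, fun x => by simp⟩
  have hνA : ∀ x, ν (A x) = ENNReal.ofReal c := by
    intro x
    rw [Measure.prod_apply (hA x), ← hfc x,
      ofReal_integral_eq_lintegral_ofReal (hInt x) (ae_of_all _ (h0 x))]
    refine lintegral_congr fun ω => ?_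
    have : Prod.mk ω ⁻¹' A x = Ioo 0 (f x ω) := rfl
    rw [this, Real.volume_Ioo, sub_zero]
  let w : Finset α → ℝ≥0∞ := fun S => if S = ∅ then 0 else ν (cell S)
  have hw : ∀ (Q : Finset α → Prop) [DecidablePred Q], ¬ Q ∅ →
      ∑ S with Q S, w S = ∑ S with Q S, ν (cell S) := by
    intro Q _ hQ
    refine Finset.sum_congr rfl fun S hS => if_neg ?_
    rintro rfl
    exact hQ (Finset.mem_filter.1 hS).2
  refine exists_pmf_setoid_of_weights w ?_ (ENNReal.ofReal c) (by simpa using hc) _ P hP ?_ ?_ ?_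
  · intro S
    rcases S.eq_empty_or_nonempty with rfl | ⟨x, hx⟩
    · simp [w]
    · refine ne_top_of_le_ne_top (b := ν (A x)) (by simp [hνA]) ?_
      have : S ≠ ∅ := by rintro rfl; simp at hx
      simp only [w, if_neg this]
      exact measure_mono fun z hz => (hz x).1 hx
  · intro x
    rw [hw (fun S => x ∈ S) (by simp), hunion (fun S => x ∈ S), ← hνA x]
    simp
  · intro x y
    rw [hw (fun S => ¬ (x ∈ S ↔ y ∈ S)) (by simp), hunion (fun S => ¬ (x ∈ S ↔ y ∈ S)),
      ← ENNReal.ofReal_mul' hc.le]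
    have hms : MeasurableSet {z | ¬ (z ∈ A x ↔ z ∈ A y)} := by
      have : {z | ¬ (z ∈ A x ↔ z ∈ A y)} = symmDiff (A x) (A y) := by
        ext z; simp only [mem_ofPred_eq, mem_symmDiff]; tauto
      rw [this]
      exact (hA x).symmDiff (hA y)
    simp only [Finset.mem_filter, Finset.mem_univ, true_and]
    refine le_trans ?_ (ENNReal.ofReal_le_ofReal (hε x y))
    rw [Measure.prod_apply hms, ofReal_integral_eq_lintegral_ofReal (f := fun ω => |f x ω - f y ω|)
      ((hInt x).sub (hInt y)).abs (ae_of_all _ fun _ => abs_nonneg _)]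
    refine lintegral_mono fun ω => ?_
    calc volume (Prod.mk ω ⁻¹' {z | ¬ (z ∈ A x ↔ z ∈ A y)})
        ≤ volume (uIcc (f y ω) (f x ω)) := by
          refine measure_mono fun t ht => ?_
          simp only [A, mem_preimage, mem_ofPred_eq] at ht
          rw [mem_uIcc]
          by_contra! h
          grind
      _ = _ := by rw [uIcc_comm, uIcc, Real.volume_Icc, ← max_sub_min_eq_abs']
  · intro S hS x hx y hy
    have hS0 : S ≠ ∅ := by rintro rfl; simp at hx
    simp only [w, if_neg hS0] at hS
    obtain ⟨z, hz⟩ := nonempty_of_measure_ne_zero hS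
    have hzx := (hz x).1 hx
    have hzy := (hz y).1 hy
    exact hfP x y z.1 (hzx.1.trans hzx.2) (hzy.1.trans hzy.2)

section Gaussian

open MeasureTheory Real

variable {ι : Type*} [Fintype ι]

/-- The unnormalized density of a centred isotropic Gaussian vector. -/
def gaussianWeight (b : ℝ) (z : ι → ℝ) : ℝ := exp (-b * ∑ i, z i ^ 2)

lemma gaussianWeight_pos (b : ℝ) (z : ι → ℝ) : 0 < gaussianWeight b z := exp_pos _

@[fun_prop]
lemma continuous_gaussianWeight (b : ℝ) : Continuous (gaussianWeight b : (ι → ℝ) → ℝ) := by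
  unfold gaussianWeight
  fun_prop

lemma integrable_prod_exp_neg_mul_sq {c : ι → ℝ} (hc : ∀ i, 0 < c i) :
    Integrable fun z : ι → ℝ => ∏ i, exp (-c i * z i ^ 2) :=
  Integrable.fintype_prod_dep (f := fun i t => exp (-c i * t ^ 2)) fun i =>
    integrable_exp_neg_mul_sq (hc i)

lemma integral_prod_exp_neg_mul_sq (c : ι → ℝ) :
    ∫ z : ι → ℝ, ∏ i, exp (-c i * z i ^ 2) = ∏ i, √(π / c i) := by
  rw [integral_fintype_prod_volume_eq_prod fun i t => exp (-c i * t ^ 2)]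
  exact Finset.prod_congr rfl fun i _ => integral_gaussian (c i)

lemma gaussianWeight_eq_prod (b : ℝ) (z : ι → ℝ) :
    gaussianWeight b z = ∏ i, exp (-b * z i ^ 2) := by
  rw [gaussianWeight, Finset.mul_sum, exp_sum]

lemma integrable_gaussianWeight {b : ℝ} (hb : 0 < b) :
    Integrable (gaussianWeight b : (ι → ℝ) → ℝ) := by
  simpa only [← gaussianWeight_eq_prod] using integrable_prod_exp_neg_mul_sq fun _ : ι => hb

lemma integral_gaussianWeight (b : ℝ) :
    ∫ z : ι → ℝ, gaussianWeight b z = ∏ _i : ι, √(π / b) := by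
  simp only [gaussianWeight_eq_prod]
  exact integral_prod_exp_neg_mul_sq fun _ => b

lemma integral_gaussianWeight_pos {b : ℝ} (hb : 0 < b) :
    0 < ∫ z : ι → ℝ, gaussianWeight b z := by
  rw [integral_gaussianWeight]
  exact Finset.prod_pos fun _ _ => by positivity

/-- Translating a Gaussian by `v` moves it in `L¹` by at most a multiple of the Euclidean
norm of `v`. -/
lemma integral_abs_gaussianWeight_sub_le {b : ℝ} (hb : 0 < b) (v : ι → ℝ) :
    ∫ z, |gaussianWeight b (z - v) - gaussianWeight b z| ≤
      3 / 2 * √(b * ∑ i, v i ^ 2) * ∫ z : ι → ℝ, gaussianWeight b z := by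
  set G := ∫ z : ι → ℝ, gaussianWeight b z with hG
  set s := ∑ i, v i ^ 2 with hs
  have hs0 : 0 ≤ s := Finset.sum_nonneg fun i _ => sq_nonneg _
  rcases hs0.eq_or_lt with h0 | h0
  · have : v = 0 := by
      ext i
      have := (Finset.sum_eq_zero_iff_of_nonneg fun i _ => sq_nonneg (v i)).1 h0.symm i
        (Finset.mem_univ i)
      simpa using this
    simp [this, ← h0]
  set r := √(b * s) with hr
  have hr0 : 0 < r := sqrt_pos.2 (by positivity)
  have hr2 : r ^ 2 = b * s := sq_sqrt (by positivity)
  have hsq : ∀ z : ι → ℝ, gaussianWeight b z = gaussianWeight (b / 2) z ^ 2 := fun z => by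
    rw [gaussianWeight, gaussianWeight, ← exp_nat_mul]
    congr 1
    push_cast
    ring
  have hmul : ∀ z, gaussianWeight (b / 2) (z - v) * gaussianWeight (b / 2) z =
      exp (-(b * s / 4)) * gaussianWeight b (z - (1 / 2 : ℝ) • v) := fun z => by
    simp only [gaussianWeight, ← exp_add, hs]
    congr 1
    simp only [Finset.mul_sum, Finset.sum_div, ← Finset.sum_add_distrib, ← Finset.sum_neg_distrib,
      Pi.sub_apply, Pi.smul_apply, smul_eq_mul]
    exact Finset.sum_congr rfl fun i _ => by ring
  have hInt := integrable_gaussianWeight (ι := ι) hb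
  have hpt : ∀ z, |gaussianWeight b (z - v) - gaussianWeight b z| ≤
      (1 / r + r / 2) * (gaussianWeight b (z - v) + gaussianWeight b z) -
        2 / r * (exp (-(b * s / 4)) * gaussianWeight b (z - (1 / 2 : ℝ) • v)) := fun z => by
    rw [← hmul, hsq, hsq]
    have h1 := gaussianWeight_pos (b / 2) (z - v)
    have h2 := gaussianWeight_pos (b / 2) z
    set x := gaussianWeight (b / 2) (z - v)
    set y := gaussianWeight (b / 2) z
    have hxy : x ^ 2 - y ^ 2 = (x - y) * (x + y) := by ring
    rw [hxy, abs_mul, abs_of_pos (add_pos h1 h2)]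
    have key : 0 ≤ (2 * |x - y| - r * (x + y)) ^ 2 / (4 * r) + r / 4 * (x - y) ^ 2 := by positivity
    have : (2 * |x - y| - r * (x + y)) ^ 2 / (4 * r) =
        (x - y) ^ 2 / r - |x - y| * (x + y) + r / 4 * (x + y) ^ 2 := by
      rw [← sq_abs (x - y)]
      field_simp
      ring
    rw [this] at key
    have e : (x - y) ^ 2 / r = 1 / r * (x ^ 2 + y ^ 2) - 2 / r * (x * y) := by ring
    rw [e] at key
    nlinarith
  have hi1 : Integrable fun z => gaussianWeight b (z - v) := hInt.comp_sub_right v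
  have hi2 : Integrable fun z => gaussianWeight b (z - (1 / 2 : ℝ) • v) := hInt.comp_sub_right _
  have hi3 : Integrable fun z => gaussianWeight b (z - v) + gaussianWeight b z := hi1.add hInt
  calc _ ≤ ∫ z, ((1 / r + r / 2) * (gaussianWeight b (z - v) + gaussianWeight b z) -
        2 / r * (exp (-(b * s / 4)) * gaussianWeight b (z - (1 / 2 : ℝ) • v))) :=
        integral_mono (hi1.sub hInt).abs
          ((hi3.const_mul _).sub ((hi2.const_mul _).const_mul _)) hpt
    _ = (1 / r + r / 2) * (G + G) - 2 / r * (exp (-(b * s / 4)) * G) := by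
        rw [integral_sub (hi3.const_mul _) ((hi2.const_mul _).const_mul _),
          integral_const_mul, integral_const_mul, integral_const_mul,
          integral_add hi1 hInt, integral_sub_right_eq_self (gaussianWeight b),
          integral_sub_right_eq_self (gaussianWeight b)]
    _ ≤ 3 / 2 * r * G := by
        have hGp : 0 < G := integral_gaussianWeight_pos hb
        have hexp : 1 - b * s / 4 ≤ exp (-(b * s / 4)) := one_sub_le_exp_neg _
        rw [← hr2] at hexp ⊢
        have : 2 / r * ((1 - r ^ 2 / 4) * G) ≤ 2 / r * (exp (-(r ^ 2 / 4)) * G) := by gcongr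
        have e : 2 / r * ((1 - r ^ 2 / 4) * G) = 2 / r * G - r / 2 * G := by
          field_simp
          ring
        rw [e] at this
        have e2 : (1 / r + r / 2) * (G + G) = 2 / r * G + r * G := by ring
        rw [e2]
        linarith

lemma abs_rpow_le_mul_exp_sq {a q : ℝ} (ha : 0 < a) (hq : 0 < q) (t : ℝ) :
    |t| ^ q ≤ (q / (2 * a)) ^ (q / 2) * exp (a * t ^ 2) := by
  have h1 : |t| ^ q = (t ^ 2) ^ (q / 2) := by
    rw [← sq_abs, ← rpow_natCast, ← rpow_mul (abs_nonneg t)]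
    congr 1
    push_cast
    ring
  have h2 : t ^ 2 ≤ q / (2 * a) * exp (2 * a * t ^ 2 / q) := by
    have := add_one_le_exp (2 * a * t ^ 2 / q)
    have h3 : t ^ 2 = q / (2 * a) * (2 * a * t ^ 2 / q) := by field_simp
    calc t ^ 2 = q / (2 * a) * (2 * a * t ^ 2 / q) := h3
      _ ≤ _ := by gcongr; linarith
  calc |t| ^ q = (t ^ 2) ^ (q / 2) := h1
    _ ≤ (q / (2 * a) * exp (2 * a * t ^ 2 / q)) ^ (q / 2) := by gcongr
    _ = _ := by
      rw [mul_rpow (by positivity) (exp_pos _).le, ← exp_mul]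
      congr 2
      field_simp

lemma integrable_gaussianWeight_mul_abs_rpow {b q : ℝ} (hb : 0 < b) (hq : 0 < q) (i : ι) :
    Integrable (fun z : ι → ℝ => gaussianWeight b z * |z i| ^ q) ∧
    ∫ z : ι → ℝ, gaussianWeight b z * |z i| ^ q ≤
      2 * (q / b) ^ (q / 2) * ∫ z : ι → ℝ, gaussianWeight b z := by
  classical
  set c : ι → ℝ := fun j => if j = i then b / 2 else b with hc
  have hc0 : ∀ j, 0 < c j := fun j => by simp only [hc]; split_ifs <;> positivity
  have hInt := integrable_prod_exp_neg_mul_sq hc0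
  have hprod : ∀ z : ι → ℝ,
      ∏ j, exp (-c j * z j ^ 2) = gaussianWeight b z * exp (b / 2 * z i ^ 2) := fun z => by
    have : ∀ j, exp (-c j * z j ^ 2) =
        exp (-b * z j ^ 2) * (if j = i then exp (b / 2 * z i ^ 2) else 1) := fun j => by
      simp only [hc]
      split_ifs with h
      · rw [h, ← exp_add]; congr 1; ring
      · simp
    rw [Finset.prod_congr rfl fun j _ => this j, Finset.prod_mul_distrib, gaussianWeight_eq_prod]
    simp
  have hval : ∏ j, √(π / c j) = √2 * ∫ z : ι → ℝ, gaussianWeight b z := by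
    have : ∀ j, √(π / c j) = √(π / b) * (if j = i then √2 else 1) := fun j => by
      simp only [hc]
      split_ifs with h
      · rw [← sqrt_mul (by positivity)]; congr 1; field_simp
      · simp
    rw [Finset.prod_congr rfl fun j _ => this j, Finset.prod_mul_distrib, integral_gaussianWeight]
    simp [mul_comm]
  have hpt : ∀ z : ι → ℝ, gaussianWeight b z * |z i| ^ q ≤
      (q / b) ^ (q / 2) * ∏ j, exp (-c j * z j ^ 2) := fun z => by
    rw [hprod]
    have := abs_rpow_le_mul_exp_sq (half_pos hb) hq (z i)
    rw [mul_div_cancel₀ b two_ne_zero] at this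
    calc _ ≤ gaussianWeight b z * ((q / b) ^ (q / 2) * exp (b / 2 * z i ^ 2)) := by
          gcongr
          exact (gaussianWeight_pos b z).le
      _ = _ := by ring
  have hnn : ∀ z : ι → ℝ, 0 ≤ gaussianWeight b z * |z i| ^ q := fun z =>
    mul_nonneg (gaussianWeight_pos b z).le (by positivity)
  have hI : Integrable (fun z : ι → ℝ => gaussianWeight b z * |z i| ^ q) := by
    refine (hInt.const_mul ((q / b) ^ (q / 2))).mono' ?_ (ae_of_all _ fun z => ?_)
    · refine Measurable.aestronglyMeasurable ?_
      exact (continuous_gaussianWeight b).measurable.mul (by fun_prop)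
    · rw [norm_of_nonneg (hnn z)]
      exact hpt z
  refine ⟨hI, (integral_mono hI (hInt.const_mul _) hpt).trans ?_⟩
  rw [integral_const_mul, integral_prod_exp_neg_mul_sq, hval]
  have hG := integral_gaussianWeight_pos (ι := ι) hb
  have h2 : √2 ≤ 2 := by
    rw [sqrt_le_left (by norm_num)]; norm_num
  calc (q / b) ^ (q / 2) * (√2 * ∫ z : ι → ℝ, gaussianWeight b z)
      ≤ (q / b) ^ (q / 2) * (2 * ∫ z : ι → ℝ, gaussianWeight b z) := by gcongr
    _ = _ := by ring

end Gaussian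

section Lp

open MeasureTheory Real

variable {ι : Type*} [Fintype ι]

lemma sqrt_sum_sq_le_card_rpow_mul {p : ℝ} (hp : 2 ≤ p) (v : ι → ℝ) :
    √(∑ i, v i ^ 2) ≤ (Fintype.card ι : ℝ) ^ (1 / 2 - 1 / p) * (∑ i, |v i| ^ p) ^ (1 / p) := by
  have hp0 : 0 < p := by linarith
  have h := rpow_sum_le_const_mul_sum_rpow_of_nonneg (s := Finset.univ) (f := fun i => v i ^ 2)
    (p := p / 2) (by linarith) fun i _ => sq_nonneg (v i)
  have h1 : ∀ i, (v i ^ 2) ^ (p / 2) = |v i| ^ p := fun i => by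
    rw [← sq_abs, ← rpow_natCast, ← rpow_mul (abs_nonneg _)]
    congr 1
    push_cast
    ring
  simp only [h1, Finset.card_univ] at h
  have hs : 0 ≤ ∑ i, v i ^ 2 := Finset.sum_nonneg fun i _ => sq_nonneg _
  have hS : 0 ≤ ∑ i, |v i| ^ p := Finset.sum_nonneg fun i _ => by positivity
  have h2 := rpow_le_rpow (by positivity) h (show 0 ≤ 1 / p by positivity)
  rw [← rpow_mul hs, mul_rpow (by positivity) hS, ← rpow_mul (by positivity)] at h2
  rw [sqrt_eq_rpow]
  convert h2 using 2
  · field_simp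
  · congr 1
    field_simp

lemma sum_abs_rpow_rpow_le_of_sum_abs_rpow_le {p q R : ℝ} (hq : 0 < q) (hqp : q ≤ p) (hR : 0 < R)
    (z : ι → ℝ) (h : ∑ i, |z i| ^ q ≤ R ^ q) : (∑ i, |z i| ^ p) ^ (1 / p) ≤ R := by
  have hp : 0 < p := hq.trans_le hqp
  have hle : ∀ i, |z i| / R ≤ 1 := fun i => by
    rw [div_le_one hR, ← rpow_le_rpow_iff (abs_nonneg _) hR.le hq]
    exact (Finset.single_le_sum (f := fun i => |z i| ^ q) (fun i _ => by positivity)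
      (Finset.mem_univ i)).trans h
  have h1 : ∑ i, |z i| ^ p ≤ R ^ p := by
    have h2 : ∑ i, (|z i| / R) ^ p ≤ ∑ i, (|z i| / R) ^ q := Finset.sum_le_sum fun i _ =>
      rpow_le_rpow_of_exponent_ge_of_imp (by positivity) (hle i) hqp (fun _ h => absurd h hp.ne')
    simp only [div_rpow (abs_nonneg _) hR.le, ← Finset.sum_div] at h2
    have h3 := h2.trans ((div_le_one (by positivity)).2 h)
    exact (div_le_one (by positivity)).1 h3
  calc (∑ i, |z i| ^ p) ^ (1 / p) ≤ (R ^ p) ^ (1 / p) := by gcongr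
    _ = R := by rw [← rpow_mul hR.le, mul_one_div_cancel hp.ne', rpow_one]

/-- A Gaussian of variance about `R² / (q (card ι)^(2/q))` has, in the sense of a Markov bound on
the `q`-th moment, at least half of its mass where the `ℓ_q` norm is at most `R`. -/
lemma integral_gaussianWeight_mul_sum_le [Nonempty ι] {q R : ℝ} (hq : 2 ≤ q) (hR : 0 < R) :
    (∫ z : ι → ℝ, gaussianWeight (q * (3 * (Fintype.card ι : ℝ) ^ (1 / q) / R) ^ 2) z *
        ((∑ i, |z i| ^ q) / R ^ q)) ≤
      1 / 2 * ∫ z : ι → ℝ, gaussianWeight (q * (3 * (Fintype.card ι : ℝ) ^ (1 / q) / R) ^ 2) z := by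
  have hq0 : 0 < q := by linarith
  have hd : 0 < (Fintype.card ι : ℝ) := by exact_mod_cast Fintype.card_pos
  set n := (Fintype.card ι : ℝ) with hn
  set b := q * (3 * n ^ (1 / q) / R) ^ 2 with hb
  have hb0 : 0 < b := by positivity
  set G := ∫ z : ι → ℝ, gaussianWeight b z with hG
  have hG0 : 0 < G := integral_gaussianWeight_pos hb0
  have hqb : (q / b) ^ (q / 2) = R ^ q / (3 ^ q * n) := by
    have e : q / b = (R / (3 * n ^ (1 / q))) ^ 2 := by
      rw [hb]; field_simp
    rw [e, ← rpow_natCast, ← rpow_mul (by positivity), div_rpow hR.le (by positivity),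
      mul_rpow (by positivity) (by positivity)]
    have e1 : ((2 : ℕ) : ℝ) * (q / 2) = q := by push_cast; ring
    rw [e1, ← rpow_mul hd.le]
    have e2 : 1 / q * q = 1 := by field_simp
    rw [e2, rpow_one]
  have hsplit : ∀ z : ι → ℝ, gaussianWeight b z * ((∑ i, |z i| ^ q) / R ^ q) =
      (R ^ q)⁻¹ * ∑ i, gaussianWeight b z * |z i| ^ q := fun z => by
    rw [← Finset.mul_sum]; ring
  simp only [hsplit]
  rw [integral_const_mul,
    integral_finsetSum _ fun i _ => (integrable_gaussianWeight_mul_abs_rpow hb0 hq0 i).1]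
  have h9 : (9 : ℝ) ≤ 3 ^ q := by
    calc (9 : ℝ) = 3 ^ (2 : ℝ) := by norm_num
      _ ≤ 3 ^ q := rpow_le_rpow_of_exponent_le (by norm_num) hq
  calc (R ^ q)⁻¹ * ∑ i, ∫ z : ι → ℝ, gaussianWeight b z * |z i| ^ q
      ≤ (R ^ q)⁻¹ * ∑ _i : ι, 2 * (q / b) ^ (q / 2) * G := by
        gcongr with i
        exact (integrable_gaussianWeight_mul_abs_rpow hb0 hq0 i).2
    _ = 2 / 3 ^ q * G := by
        rw [Finset.sum_const, Finset.card_univ, nsmul_eq_mul, ← hn, hqb]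
        field_simp
    _ ≤ 1 / 2 * G := by
        refine mul_le_mul_of_nonneg_right ?_ hG0.le
        rw [div_le_iff₀ (by positivity)]
        linarith

end Lp

lemma LipschitzDecomp.mono {α : Type*} [PseudoMetricSpace α] {β β' Δ : ℝ} (hΔ : 0 < Δ)
    (hβ : β ≤ β') (h : LipschitzDecomp α β Δ) : LipschitzDecomp α β' Δ := by
  obtain ⟨D, h1, h2⟩ := h
  refine ⟨D, h1, fun x y => (h2 x y).trans (ENNReal.ofReal_le_ofReal ?_)⟩
  gcongr

open MeasureTheory Real in
/-- Lipschitz decomposition of finite subsets of `ℓ_p^d` from a Gaussian truncated to a ball of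
`ℓ_p^d`, whose variance is tuned to an exponent `q ∈ [2, p]`. -/
lemma lipschitzDecomp_of_exponent {p q : ℝ} (hq : 2 ≤ q) (hqp : q ≤ p)
    [Fact (1 ≤ ENNReal.ofReal p)] {d : ℕ} (hd : 0 < d)
    {M : Set (PiLp (ENNReal.ofReal p) (fun _ : Fin d => ℝ))} (hM : M.Finite) {Δ : ℝ} (hΔ : 0 < Δ) :
    LipschitzDecomp M (36 * √q * (d : ℝ) ^ (1 / q - 1 / p) * √d + 8) Δ := by
  have : Fintype M := hM.fintype
  have : Nonempty (Fin d) := ⟨⟨0, hd⟩⟩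
  have hp : 2 ≤ p := hq.trans hqp
  have hp0 : 0 < p := by linarith
  have hd0 : 0 < (d : ℝ) := by exact_mod_cast hd
  set R := Δ / 4 with hR
  have hR0 : 0 < R := by positivity
  set b := q * (3 * (d : ℝ) ^ (1 / q) / R) ^ 2 with hb
  have hb0 : 0 < b := by positivity
  let N : (Fin d → ℝ) → ℝ := fun z => ‖WithLp.toLp (ENNReal.ofReal p) z‖
  have hN : ∀ z, N z = (∑ i, |z i| ^ p) ^ (1 / p) := fun z => by
    simp only [N]
    rw [PiLp.norm_eq_sum (by rw [ENNReal.toReal_ofReal hp0.le]; exact hp0),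
      ENNReal.toReal_ofReal hp0.le]
    rfl
  have hNc : Continuous N := (PiLp.continuous_toLp _ _).norm
  have hNabs : ∀ z z', |N z - N z'| ≤ N (z - z') := fun z z' => abs_norm_sub_norm_le _ _
  let φ : (Fin d → ℝ) → ℝ := fun z => max 0 (min 1 (2 - N z / R))
  have hφc : Continuous φ := by fun_prop
  have hφ0 : ∀ z, 0 ≤ φ z := fun z => le_max_left _ _
  have hφ1 : ∀ z, φ z ≤ 1 := fun z => max_le zero_le_one (min_le_left _ _)
  have hφL : ∀ z z', |φ z - φ z'| ≤ N (z - z') / R := fun z z' => by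
    calc |φ z - φ z'| ≤ |min 1 (2 - N z / R) - min 1 (2 - N z' / R)| :=
          by simpa using abs_max_sub_max_le_max 0 (min 1 (2 - N z / R)) 0 (min 1 (2 - N z' / R))
      _ ≤ |(2 - N z / R) - (2 - N z' / R)| := by
          simpa using abs_min_sub_min_le_max 1 (2 - N z / R) 1 (2 - N z' / R)
      _ = |N z - N z'| / R := by
          rw [← abs_of_pos hR0, ← abs_div, abs_of_pos hR0, abs_sub_comm]; congr 1; ring
      _ ≤ N (z - z') / R := by gcongr; exact hNabs z z'
  have hφsupp : ∀ z, 0 < φ z → N z < Δ / 2 := fun z hz => by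
    have : 0 < 2 - N z / R := by
      by_contra! h
      exact hz.ne' (max_eq_left ((min_le_right _ _).trans h))
    have h2 : N z / R < 2 := by linarith
    rw [div_lt_iff₀ hR0] at h2
    linarith
  have hφtail : ∀ z, 1 - φ z ≤ (∑ i, |z i| ^ q) / R ^ q := fun z => by
    have hnn : 0 ≤ ∑ i, |z i| ^ q := Finset.sum_nonneg fun i _ => by positivity
    rcases le_total (∑ i, |z i| ^ q) (R ^ q) with h | h
    · have h1 : N z ≤ R := by
        rw [hN]
        exact sum_abs_rpow_rpow_le_of_sum_abs_rpow_le (by linarith) hqp hR0 z h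
      have h2 : N z / R ≤ 1 := (div_le_one hR0).2 h1
      have h3 : φ z = 1 := by
        simp only [φ]
        rw [min_eq_left (by linarith), max_eq_right zero_le_one]
      rw [h3, sub_self]
      positivity
    · exact (sub_le_self 1 (hφ0 z)).trans ((one_le_div (by positivity)).2 h)
  have hg : Integrable (gaussianWeight b : (Fin d → ℝ) → ℝ) := integrable_gaussianWeight hb0
  have hgp : ∀ z : Fin d → ℝ, 0 < gaussianWeight b z := gaussianWeight_pos b
  set G := ∫ z : Fin d → ℝ, gaussianWeight b z with hG
  have hG0 : 0 < G := integral_gaussianWeight_pos hb0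
  let F : (Fin d → ℝ) → ℝ := fun z => gaussianWeight b z * φ z
  have hFc : Continuous F := (continuous_gaussianWeight b).mul hφc
  have hF0 : ∀ z, 0 ≤ F z := fun z => mul_nonneg (hgp z).le (hφ0 z)
  have hFi : Integrable F := hg.mono' hFc.aestronglyMeasurable (ae_of_all _ fun z => by
    rw [norm_of_nonneg (hF0 z)]
    exact mul_le_of_le_one_right (hgp z).le (hφ1 z))
  set c := ∫ z, F z with hc
  have hcG : G / 2 ≤ c := by
    have htail := integral_gaussianWeight_mul_sum_le (ι := Fin d) hq hR0
    rw [Fintype.card_fin, ← hb, ← hG] at htail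
    have hle : ∫ z : Fin d → ℝ, (gaussianWeight b z - F z) ≤
        ∫ z : Fin d → ℝ, gaussianWeight b z * ((∑ i, |z i| ^ q) / R ^ q) := by
      refine integral_mono (hg.sub hFi) ?_ fun z => ?_
      · have := (integrable_finsetSum Finset.univ fun i _ =>
          (integrable_gaussianWeight_mul_abs_rpow (ι := Fin d) hb0
            (show 0 < q by linarith) i).1).div_const (R ^ q)
        refine this.congr (ae_of_all _ fun z => ?_)
        simp only [← Finset.mul_sum, mul_div_assoc]
      · have := mul_le_mul_of_nonneg_left (hφtail z) (hgp z).le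
        simp only [F]
        linarith
    rw [integral_sub hg hFi] at hle
    linarith
  have hc0 : 0 < c := by linarith
  have hdist : ∀ x y : M, dist x y = N (x.1.ofLp - y.1.ofLp) := fun x y => by
    rw [Subtype.dist_eq, dist_eq_norm]
    rfl
  refine exists_pmf_setoid_of_densities volume (fun (x : M) ω => F (ω - x.1.ofLp))
    (fun x => by fun_prop) (fun x => hFi.comp_sub_right _) (fun x ω => hF0 _) c hc0
    (fun x => integral_sub_right_eq_self F _) _ (fun x y => ?_) (fun x y => dist x y ≤ Δ)
    (fun x => by simpa using hΔ.le) (fun x y ω hx hy => ?_)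
  · set v := x.1.ofLp - y.1.ofLp with hv
    have hpt : ∀ ω, |F (ω - x.1.ofLp) - F (ω - y.1.ofLp)| ≤
        |gaussianWeight b (ω - x.1.ofLp) - gaussianWeight b (ω - y.1.ofLp)| +
          gaussianWeight b (ω - y.1.ofLp) * (N v / R) := fun ω => by
      have hNv : N (ω - x.1.ofLp - (ω - y.1.ofLp)) = N v := by
        simp only [N, hv]
        rw [← norm_neg, ← WithLp.toLp_neg]
        congr 2
        abel
      have h1 := hφL (ω - x.1.ofLp) (ω - y.1.ofLp)
      rw [hNv] at h1
      set z := ω - x.1.ofLp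
      set z' := ω - y.1.ofLp
      have e : F z - F z' = (gaussianWeight b z - gaussianWeight b z') * φ z +
          gaussianWeight b z' * (φ z - φ z') := by simp only [F]; ring
      rw [e]
      refine (abs_add_le _ _).trans (add_le_add ?_ ?_)
      · rw [abs_mul, abs_of_nonneg (hφ0 z)]
        exact mul_le_of_le_one_right (abs_nonneg _) (hφ1 z)
      · rw [abs_mul, abs_of_pos (hgp z')]
        exact mul_le_mul_of_nonneg_left h1 (hgp z').le
    have hgx := hg.comp_sub_right x.1.ofLp
    have hgy := hg.comp_sub_right y.1.ofLp
    have hshift : ∫ ω, |gaussianWeight b (ω - x.1.ofLp) - gaussianWeight b (ω - y.1.ofLp)| =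
        ∫ ω, |gaussianWeight b (ω - v) - gaussianWeight b ω| := by
      rw [← integral_sub_right_eq_self
        (fun ω => |gaussianWeight b (ω - v) - gaussianWeight b ω|) y.1.ofLp]
      simp only [hv, sub_sub, add_sub_cancel]
    have hNv0 : 0 ≤ N v := norm_nonneg _
    have hsqrt : √(b * ∑ i, v i ^ 2) ≤
        12 * √q * (d : ℝ) ^ (1 / q - 1 / p) * √d * N v / Δ := by
      have h1 := sqrt_sum_sq_le_card_rpow_mul hp v
      rw [← hN, Fintype.card_fin] at h1
      have h2 : √b = √q * (3 * (d : ℝ) ^ (1 / q) / R) := by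
        rw [hb, sqrt_mul (by linarith), sqrt_sq (by positivity)]
      have h3 : (d : ℝ) ^ (1 / q) * (d : ℝ) ^ (1 / 2 - 1 / p) =
          (d : ℝ) ^ (1 / q - 1 / p) * √d := by
        rw [sqrt_eq_rpow, ← rpow_add hd0, ← rpow_add hd0]
        congr 1
        ring
      rw [sqrt_mul hb0.le, h2]
      calc √q * (3 * (d : ℝ) ^ (1 / q) / R) * √(∑ i, v i ^ 2)
          ≤ √q * (3 * (d : ℝ) ^ (1 / q) / R) * ((d : ℝ) ^ (1 / 2 - 1 / p) * N v) := by gcongr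
        _ = 12 * √q * ((d : ℝ) ^ (1 / q) * (d : ℝ) ^ (1 / 2 - 1 / p)) * N v / Δ := by
            rw [hR]; field_simp; ring
        _ = _ := by rw [h3]; ring
    rw [hdist x y, ← hv]
    calc ∫ ω, |F (ω - x.1.ofLp) - F (ω - y.1.ofLp)|
        ≤ ∫ ω, (|gaussianWeight b (ω - x.1.ofLp) - gaussianWeight b (ω - y.1.ofLp)| +
          gaussianWeight b (ω - y.1.ofLp) * (N v / R)) :=
          integral_mono ((hFi.comp_sub_right _).sub (hFi.comp_sub_right _)).abs
            ((hgx.sub hgy).abs.add (hgy.mul_const _)) hpt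
      _ = (∫ ω, |gaussianWeight b (ω - v) - gaussianWeight b ω|) + G * (N v / R) := by
          rw [← hshift, hG, ← integral_sub_right_eq_self (gaussianWeight b) y.1.ofLp,
            ← integral_mul_const]
          exact integral_add (hgx.sub hgy).abs (hgy.mul_const _)
      _ ≤ 3 / 2 * √(b * ∑ i, v i ^ 2) * G + G * (N v / R) := by
          gcongr
          exact integral_abs_gaussianWeight_sub_le hb0 v
      _ ≤ 3 / 2 * (12 * √q * (d : ℝ) ^ (1 / q - 1 / p) * √d * N v / Δ) * G + G * (N v / R) := by
          gcongr
      _ = (36 * √q * (d : ℝ) ^ (1 / q - 1 / p) * √d + 8) * N v / Δ * (G / 2) := by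
          rw [hR]; field_simp; ring
      _ ≤ _ := by gcongr
  · have hx' := hφsupp _ (pos_of_mul_pos_right hx (hgp _).le)
    have hy' := hφsupp _ (pos_of_mul_pos_right hy (hgp _).le)
    rw [hdist]
    have h1 := hNabs (ω - y.1.ofLp) (ω - x.1.ofLp)
    have h2 : N (x.1.ofLp - y.1.ofLp) ≤ N (ω - y.1.ofLp) + N (ω - x.1.ofLp) := by
      have := norm_sub_le (WithLp.toLp (ENNReal.ofReal p) (ω - y.1.ofLp))
        (WithLp.toLp (ENNReal.ofReal p) (ω - x.1.ofLp))
      rw [← WithLp.toLp_sub] at this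
      simpa [N] using this
    linarith

/-- There is a universal constant `C > 0` such that for every real `p ≥ 2`, every integer
`d ≥ 3`, every finite subset `M` of `ℓ_p^d`, and every `Δ > 0`, the metric space `M`
admits a `(C * (min p (log d))^4 * √d, Δ)`-Lipschitz decomposition. -/
theorem lipschitz_decomposition_lp_d_dim :
    ∃ C : ℝ, 0 < C ∧
      ∀ (p : ℝ), 2 ≤ p →
      ∀ [Fact (1 ≤ ENNReal.ofReal p)],
      ∀ (d : ℕ), 3 ≤ d →
      ∀ (M : Set (PiLp (ENNReal.ofReal p) (fun _ : Fin d => ℝ))),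
        M.Finite →
        ∀ Δ : ℝ, 0 < Δ →
          LipschitzDecomp M (C * min p (Real.log d) ^ 4 * Real.sqrt d) Δ := by
  refine ⟨224, by norm_num, fun p hp _ d hd M hM Δ hΔ => ?_⟩
  have hd3 : (3 : ℝ) ≤ d := by exact_mod_cast hd
  have hd0 : (0 : ℝ) < d := by linarith
  have hlog : 1 ≤ Real.log d := by
    rw [Real.le_log_iff_exp_le hd0]
    linarith [Real.exp_one_lt_d9]
  set m := min p (Real.log d) with hm
  have hm1 : 1 ≤ m := le_min (by linarith) hlog
  have hm4 : m ≤ m ^ 4 := le_self_pow₀ hm1 (by norm_num)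
  have hqp : max 2 m ≤ p := max_le hp (min_le_left _ _)
  have hq2 : 2 ≤ max 2 m := le_max_left _ _
  have hqm : max 2 m ≤ 2 * m := max_le (by linarith) (by linarith)
  refine (lipschitzDecomp_of_exponent hq2 hqp (by omega) hM hΔ).mono hΔ ?_
  set q := max 2 m with hq
  have hpow : (d : ℝ) ^ (1 / q - 1 / p) ≤ 3 := by
    rcases le_total p (Real.log d) with h | h
    · have : q = p := le_antisymm hqp (by rw [hq, hm, min_eq_left h]; exact le_max_right _ _)
      rw [this, sub_self, Real.rpow_zero]
      norm_num
    · have hlq : Real.log d ≤ q := by rw [hq, hm, min_eq_right h]; exact le_max_right _ _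
      rw [Real.rpow_def_of_pos hd0]
      have h1 : Real.log d * (1 / q - 1 / p) ≤ 1 := by
        have : Real.log d / q ≤ 1 := (div_le_one (by linarith)).2 hlq
        have h2 : 0 ≤ Real.log d / p := by positivity
        calc _ = Real.log d / q - Real.log d / p := by ring
          _ ≤ 1 := by linarith
      exact (Real.exp_le_exp.2 h1).trans (by linarith [Real.exp_one_lt_d9])
  have hsq : Real.sqrt q ≤ 2 * m ^ 4 := by
    have : Real.sqrt q ≤ q := by
      rw [Real.sqrt_le_left (by linarith)]
      nlinarith
    linarith
  have hsd : 1 ≤ Real.sqrt d := Real.one_le_sqrt.2 (by linarith)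
  have hms : 1 ≤ m ^ 4 * Real.sqrt d := one_le_mul_of_one_le_of_one_le (hm1.trans hm4) hsd
  calc 36 * Real.sqrt q * (d : ℝ) ^ (1 / q - 1 / p) * Real.sqrt d + 8
      ≤ 36 * (2 * m ^ 4) * 3 * Real.sqrt d + 8 * (m ^ 4 * Real.sqrt d) := by
        gcongr
        linarith
    _ = 224 * m ^ 4 * Real.sqrt d := by ring
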